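/- For every fixed natural number m ≥ 1, the logic LTL_NT(m) is decidable: there is an algorithm which, given any LTL formula φ, decides whether φ ∈ LTL_NT(m). -/

import Mathlib

/-- LTL formulas: letters, falsum, implication, Next, Until.
Other Boolean connectives are defined as abbreviations. -/
inductive Fml : Type
  | letter : ℕ → Fml
  | bot : Fml
  | imp : Fml → Fml → Fml
  | next : Fml → Fml
  | untl : Fml → Fml → Fml
deriving DecidableEq

namespace Fml
def neg (φ : Fml) : Fml := imp φ bot
def top : Fml := neg bot
def conj (φ ψ : Fml) : Fml := neg (imp φ (neg ψ))
def disj (φ ψ : Fml) : Fml := imp (neg φ) ψ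
/-- □φ abbreviates ¬(⊤ U ¬φ). -/
def box (φ : Fml) : Fml := neg (untl top (neg φ))
end Fml

/-- Truth in a model on the non-transitive linear frame determined by `t : ℕ → ℕ`:
`φ U ψ` at `a` looks only as far as `t a`. -/
def sat (t : ℕ → ℕ) (V : ℕ → Set ℕ) : Fml → ℕ → Prop
  | .letter p, a => a ∈ V p
  | .bot, _ => False
  | .imp φ ψ, a => sat t V φ a → sat t V ψ a
  | .next φ, a => sat t V φ (a + 1)
  | .untl φ ψ, a => ∃ b, a ≤ b ∧ b ≤ t a ∧ sat t V ψ b ∧ ∀ c, a ≤ c → c < b → sat t V φ c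

/-- A non-transitive linear frame: `t i > i` and `t` is increasing on successive points. -/
def NTFrame (t : ℕ → ℕ) : Prop := (∀ i, i < t i) ∧ (∀ i, t i < t (i + 1))

/-- The logic LTL_NT. -/
def LTLNT : Set Fml := {φ | ∀ t, NTFrame t → ∀ V a, sat t V φ a}

/-- Standard LTL semantics on ⟨ℕ, ≤, Next⟩. -/
def satStd (V : ℕ → Set ℕ) : Fml → ℕ → Prop
  | .letter p, a => a ∈ V p
  | .bot, _ => False
  | .imp φ ψ, a => satStd V φ a → satStd V ψ a
  | .next φ, a => satStd V φ (a + 1)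
  | .untl φ ψ, a => ∃ b, a ≤ b ∧ satStd V ψ b ∧ ∀ c, a ≤ c → c < b → satStd V φ c

/-- The standard linear temporal logic LTL. -/
def LTL : Set Fml := {φ | ∀ V a, satStd V φ a}

/-- The logic LTL_NT(m) of uniform intransitivity `m` (frame with `t i = i + m`). -/
def LTLNTm (m : ℕ) : Set Fml := {φ | ∀ V a, sat (· + m) V φ a}

/-- An inference rule: a finite list of premises and a conclusion. -/
structure Rule where
  prem : List Fml
  concl : Fml

/-- A rule is valid in a model iff truth of all premises at all points implies
truth of the conclusion at all points. -/
def validInModel (t : ℕ → ℕ) (V : ℕ → Set ℕ) (r : Rule) : Prop :=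
  (∀ φ ∈ r.prem, ∀ a, sat t V φ a) → ∀ a, sat t V r.concl a

/-- A rule is valid in a frame iff it is valid in every model on it. -/
def validInFrame (t : ℕ → ℕ) (r : Rule) : Prop := ∀ V, validInModel t V r

/-- Size of a formula. -/
def Fml.size : Fml → ℕ
  | .letter _ => 1
  | .bot => 1
  | .imp φ ψ => φ.size + ψ.size + 1
  | .next φ => φ.size + 1
  | .untl φ ψ => φ.size + ψ.size + 1

/-- Size of a rule. -/
def Rule.size (r : Rule) : ℕ := (r.prem.map Fml.size).sum + r.concl.size

/-- An injective encoding of formulas into ℕ (to speak about computability). -/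
def encF : Fml → ℕ
  | .letter p => Nat.pair 0 p
  | .bot => Nat.pair 1 0
  | .imp φ ψ => Nat.pair 2 (Nat.pair (encF φ) (encF ψ))
  | .next φ => Nat.pair 3 (encF φ)
  | .untl φ ψ => Nat.pair 4 (Nat.pair (encF φ) (encF ψ))

def encL : List Fml → ℕ
  | [] => 0
  | φ :: l => Nat.pair (encF φ) (encL l) + 1

/-- An injective encoding of rules into ℕ. -/
def encRule (r : Rule) : ℕ := Nat.pair (encL r.prem) (encF r.concl)

/-- A literal: `φ` or `¬φ` according to a Boolean flag (`α⁰ = α`, `α¹ = ¬α`). -/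
def lit (b : Bool) (φ : Fml) : Fml := if b then φ else φ.neg

/-- Conjunction of a list of formulas. -/
def bigConj : List Fml → Fml
  | [] => Fml.top
  | φ :: l => (bigConj l).conj φ

/-- Disjunction of a list of formulas. -/
def bigDisj : List Fml → Fml
  | [] => Fml.bot
  | φ :: l => (bigDisj l).disj φ

/-- The premise of a rule in reduced normal form: a disjunction over `j < l` of
conjunctions of literals over `xᵢ`, `N xᵢ` (for `i < n`) and `xᵢ U x_k` (for `i ≠ k`). -/
def rnfPremise (n l : ℕ) (t0 t1 : Fin l → Fin n → Bool)
    (t2 : Fin l → Fin n → Fin n → Bool) : Fml :=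
  bigDisj ((List.finRange l).map fun j =>
    bigConj ((List.finRange n).map (fun i => lit (t0 j i) (.letter i)) ++
      (List.finRange n).map (fun i => lit (t1 j i) (.next (.letter i))) ++
      ((List.finRange n).flatMap fun i =>
        ((List.finRange n).filter (fun k => k ≠ i)).map fun k =>
          lit (t2 j i k) (.untl (.letter i) (.letter k))))) 

/-- `IsRNF n l r`: the rule `r` is in reduced normal form with `n` letters and
`l` disjuncts, i.e. of the shape `ε / x₁`. -/
def IsRNF (n l : ℕ) (r : Rule) : Prop :=
  0 < n ∧ 0 < l ∧ r.concl = .letter 0 ∧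
    ∃ t0 t1 t2, r.prem = [rnfPremise n l t0 t1 t2]

/-- Next relation of the finite frame ℱ(N(r)): it wraps the last point `T` to `g`. -/
def wNext (T g : ℕ) (a : ℕ) : ℕ := if a = T then g else a + 1

/-- Truth in a model on the finite frame `ℱ(N(r))` obtained from the frame of `t`:
the base set is `[0, t^[r+1] 0]`, `T = t^[r+1] 0` is the last point, whose `Next` is
`G = t^[g] 0`; `until` from `a` follows `wNext` for at most `t a - a` steps, so on the
last interval it acts as if the interval following it were `[t^[g] 0, t^[g+1] 0]`. -/
def satFin (t : ℕ → ℕ) (T G : ℕ) (V : ℕ → Set ℕ) : Fml → ℕ → Prop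
  | .letter p, a => a ∈ V p
  | .bot, _ => False
  | .imp φ ψ, a => satFin t T G V φ a → satFin t T G V ψ a
  | .next φ, a => satFin t T G V φ (wNext T G a)
  | .untl φ ψ, a => ∃ k, k ≤ t a - a ∧ satFin t T G V ψ ((wNext T G)^[k] a) ∧
      ∀ j < k, satFin t T G V φ ((wNext T G)^[j] a)

/-- `r` is refuted by `V` in the finite frame `ℱ(N(rr))` (with parameter `g`) built
from the frame of `t`: all premises hold at every point of the frame, while the
conclusion fails at some point. -/
def refutedFin (t : ℕ → ℕ) (rr g : ℕ) (V : ℕ → Set ℕ) (r : Rule) : Prop :=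
  (∀ φ ∈ r.prem, ∀ a ≤ t^[rr + 1] 0, satFin t (t^[rr + 1] 0) (t^[g] 0) V φ a) ∧
    ∃ a ≤ t^[rr + 1] 0, ¬ satFin t (t^[rr + 1] 0) (t^[g] 0) V r.concl a

/-- Temporal degree: maximal nesting depth of `N` and `U`. -/
def tdeg : Fml → ℕ
  | .letter _ => 0
  | .bot => 0
  | .imp φ ψ => max (tdeg φ) (tdeg ψ)
  | .next φ => tdeg φ + 1
  | .untl φ ψ => max (tdeg φ) (tdeg ψ) + 1

/-- `i`-fold application of `N`. -/
def nPow : ℕ → Fml → Fml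
  | 0, φ => φ
  | k + 1, φ => .next (nPow k φ)

/-- Substitution of formulas for letters. -/
def subst (σ : ℕ → Fml) : Fml → Fml
  | .letter p => σ p
  | .bot => .bot
  | .imp φ ψ => .imp (subst σ φ) (subst σ ψ)
  | .next φ => .next (subst σ φ)
  | .untl φ ψ => .untl (subst σ φ) (subst σ ψ)

/-- A rule is admissible in a logic `L` iff every substitution making all premises
theorems of `L` makes the conclusion a theorem of `L`. -/
def Admissible (L : Set Fml) (r : Rule) : Prop :=
  ∀ σ : ℕ → Fml, (∀ φ ∈ r.prem, subst σ φ ∈ L) → subst σ r.concl ∈ L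


namespace NTDec

/-- truth bit of the letter-position index `k` in the coded valuation `v` -/
def bit (v k : ℕ) : Bool := decide (v / 2 ^ k % 2 = 1)

/-- look up a table of truth values -/
def look (L : List (List Bool)) (x a : ℕ) : Bool := (L.getD x []).getD a false

/-- bounded until on truth tables -/
def unt : ℕ → List (List Bool) → ℕ → ℕ → ℕ → Bool
  | 0, L, _, y, a => look L y a
  | k + 1, L, x, y, a => look L y a || (look L x a && unt k L x y (a + 1))

def stepBit (m v : ℕ) (L : List (List Bool)) (a : ℕ) : Bool :=
  let n := L.length
  let t := n.unpair.1
  let r := n.unpair.2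
  if t = 0 then bit v (Nat.pair r a)
  else if t = 1 then false
  else if t = 2 then (!(look L r.unpair.1 a) || look L r.unpair.2 a)
  else if t = 3 then look L r (a + 1)
  else unt m L r.unpair.1 r.unpair.2 a

def step (m v A : ℕ) (L : List (List Bool)) : List Bool :=
  (List.range (A + 1)).map (stepBit m v L)

def table (m v A : ℕ) : ℕ → List (List Bool)
  | 0 => []
  | n + 1 => table m v A n ++ [step m v A (table m v A n)]

theorem pow_prim : Primrec fun k : ℕ => 2 ^ k := by
  refine (Primrec.nat_rec₁ (f := fun _ x => 2 * x) 1
    (Primrec.nat_double.comp Primrec.snd).to₂).of_eq fun n => ?_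
  induction n with
  | zero => rfl
  | succ n ih => simp only [ih, pow_succ]; ring

theorem bit_prim : Primrec₂ bit := by
  unfold bit
  exact (Primrec.eq.comp (Primrec.nat_mod.comp
    (Primrec.nat_div.comp Primrec.fst (pow_prim.comp Primrec.snd)) (Primrec.const 2))
    (Primrec.const 1)).decide.to₂

theorem look_prim {α : Type*} [Primcodable α] {f : α → List (List Bool)} {g h : α → ℕ}
    (hf : Primrec f) (hg : Primrec g) (hh : Primrec h) :
    Primrec fun z => look (f z) (g z) (h z) :=
  (Primrec.list_getD false).comp ((Primrec.list_getD []).comp hf hg) hh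

theorem unt_prim {α : Type*} [Primcodable α] {f : α → List (List Bool)} {g g' : α → ℕ}
    (hf : Primrec f) (hg : Primrec g) (hg' : Primrec g') (m : ℕ) : ∀ {h : α → ℕ}, Primrec h →
    Primrec fun z => unt m (f z) (g z) (g' z) (h z) := by
  induction m with
  | zero => intro h hh; exact look_prim hf hg' hh
  | succ k ih =>
    intro h hh
    exact Primrec.or.comp (look_prim hf hg' hh)
      (Primrec.and.comp (look_prim hf hg hh) (ih (Primrec.succ.comp hh)))

theorem stepBit_prim (m : ℕ) {α : Type*} [Primcodable α] {v : α → ℕ} {f : α → List (List Bool)}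
    {h : α → ℕ} (hv : Primrec v) (hf : Primrec f) (hh : Primrec h) :
    Primrec fun z => stepBit m (v z) (f z) (h z) := by
  have hn : Primrec fun z => (f z).length.unpair := Primrec.unpair.comp (Primrec.list_length.comp hf)
  have ht : Primrec fun z => (f z).length.unpair.1 := Primrec.fst.comp hn
  have hr : Primrec fun z => (f z).length.unpair.2 := Primrec.snd.comp hn
  have h1 : Primrec fun z => (f z).length.unpair.2.unpair.1 :=
    Primrec.fst.comp (Primrec.unpair.comp hr)
  have h2 : Primrec fun z => (f z).length.unpair.2.unpair.2 :=
    Primrec.snd.comp (Primrec.unpair.comp hr)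
  unfold stepBit
  refine Primrec.ite (Primrec.eq.comp ht (Primrec.const 0))
    (bit_prim.comp hv (Primrec₂.natPair.comp hr hh)) ?_
  refine Primrec.ite (Primrec.eq.comp ht (Primrec.const 1)) (Primrec.const false) ?_
  refine Primrec.ite (Primrec.eq.comp ht (Primrec.const 2))
    (Primrec.or.comp (Primrec.not.comp (look_prim hf h1 hh)) (look_prim hf h2 hh)) ?_
  exact Primrec.ite (Primrec.eq.comp ht (Primrec.const 3))
    (look_prim hf hr (Primrec.succ.comp hh)) (unt_prim hf h1 h2 m hh)

theorem step_prim (m : ℕ) {α : Type*} [Primcodable α] {v A : α → ℕ} {f : α → List (List Bool)}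
    (hv : Primrec v) (hA : Primrec A) (hf : Primrec f) :
    Primrec fun z => step m (v z) (A z) (f z) :=
  Primrec.list_map (Primrec.list_range.comp (Primrec.succ.comp hA))
    (stepBit_prim m (hv.comp Primrec.fst) (hf.comp Primrec.fst) Primrec.snd).to₂

theorem table_prim (m : ℕ) : Primrec₂ fun (z : ℕ × ℕ) n => table m z.1 z.2 n := by
  refine (Primrec.nat_rec (f := fun _ : ℕ × ℕ => ([] : List (List Bool)))
    (g := fun z p => p.2 ++ [step m z.1 z.2 p.2]) (Primrec.const []) ?_).of_eq ?_
  · exact (Primrec.list_concat.comp (Primrec.snd.comp Primrec.snd)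
      (step_prim m (Primrec.fst.comp Primrec.fst) (Primrec.snd.comp Primrec.fst)
        (Primrec.snd.comp Primrec.snd))).to₂
  · intro z n
    induction n with
    | zero => rfl
    | succ n ih => simp only [table, ← ih]

theorem table_length (m v A n : ℕ) : (table m v A n).length = n := by
  induction n with
  | zero => rfl
  | succ n ih => simp [table, ih]

theorem table_get (m v A n x : ℕ) (h : x < n) :
    (table m v A n).getD x [] = step m v A (table m v A x) := by
  induction n with
  | zero => omega
  | succ n ih =>
    rcases Nat.lt_succ_iff_lt_or_eq.1 h with h | rfl
    · rw [table, List.getD_append _ _ _ _ (by rw [table_length]; exact h), ih h]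
    · rw [table, List.getD_append_right _ _ _ _ (by rw [table_length]), table_length]
      simp

theorem look_table (m v A n x a : ℕ) (h : x < n) (ha : a ≤ A) :
    look (table m v A n) x a = stepBit m v (table m v A x) a := by
  rw [look, table_get _ _ _ _ _ h, step, List.getD_eq_getElem _ _ (by simp; omega)]
  simp

/-- the valuation coded by `v` -/
def val (v : ℕ) : ℕ → Set ℕ := fun p => {i | bit v (Nat.pair p i) = true}

theorem lt_pair_pos (t x : ℕ) (h : 0 < t) : x < Nat.pair t x :=
  lt_of_le_of_lt (Nat.right_le_pair 0 x) (Nat.pair_lt_pair_left x h)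

theorem unt_iff (L : List (List Bool)) (x y : ℕ) (P Q : ℕ → Prop) (A : ℕ)
    (hx : ∀ a ≤ A, (look L x a = true ↔ P a)) (hy : ∀ a ≤ A, (look L y a = true ↔ Q a)) :
    ∀ k a, a + k ≤ A → (unt k L x y a = true ↔
      ∃ b, a ≤ b ∧ b ≤ a + k ∧ Q b ∧ ∀ c, a ≤ c → c < b → P c) := by
  intro k
  induction k with
  | zero =>
    intro a ha
    rw [unt, hy a ha]
    constructor
    · intro h; exact ⟨a, le_rfl, le_rfl, h, fun c h1 h2 => by omega⟩
    · rintro ⟨b, h1, h2, h3, -⟩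
      obtain rfl : a = b := by omega
      exact h3
  | succ k ih =>
    intro a ha
    rw [unt, Bool.or_eq_true, Bool.and_eq_true, hy a (by omega), hx a (by omega),
      ih (a + 1) (by omega)]
    constructor
    · rintro (h | ⟨hp, b, h1, h2, h3, h4⟩)
      · exact ⟨a, le_rfl, by omega, h, fun c h1 h2 => by omega⟩
      · refine ⟨b, by omega, by omega, h3, fun c h5 h6 => ?_⟩
        rcases Nat.eq_or_lt_of_le h5 with rfl | h7
        · exact hp
        · exact h4 c h7 h6
    · rintro ⟨b, h1, h2, h3, h4⟩
      rcases Nat.eq_or_lt_of_le h1 with rfl | h7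
      · exact Or.inl h3
      · exact Or.inr ⟨h4 a le_rfl h7, b, h7, by omega, h3, fun c h5 h6 => h4 c (by omega) h6⟩

theorem correct (m v A : ℕ) (hm : 1 ≤ m) (φ : Fml) : ∀ a, a + m * tdeg φ ≤ A →
    (stepBit m v (table m v A (encF φ)) a = true ↔ sat (· + m) (val v) φ a) := by
  induction φ with
  | letter p => intro a _; simp [stepBit, table_length, encF, sat, val]
  | bot => intro a _; simp [stepBit, table_length, encF, sat]
  | imp φ ψ ih1 ih2 =>
    intro a ha
    have l1 : encF φ < encF (.imp φ ψ) :=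
      lt_of_le_of_lt (Nat.left_le_pair _ _) (lt_pair_pos 2 _ (by omega))
    have l2 : encF ψ < encF (.imp φ ψ) :=
      lt_of_le_of_lt (Nat.right_le_pair _ _) (lt_pair_pos 2 _ (by omega))
    have d1 : m * tdeg φ ≤ m * tdeg (.imp φ ψ) := Nat.mul_le_mul_left _ (le_max_left _ _)
    have d2 : m * tdeg ψ ≤ m * tdeg (.imp φ ψ) := Nat.mul_le_mul_left _ (le_max_right _ _)
    rw [sat, ← ih1 a (by omega), ← ih2 a (by omega),
      ← look_table m v A _ _ a l1 (by omega), ← look_table m v A _ _ a l2 (by omega)]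
    have e : (encF (.imp φ ψ)).unpair = (2, Nat.pair (encF φ) (encF ψ)) := by simp [encF]
    simp only [stepBit, table_length, e]
    cases h : look (table m v A (encF (.imp φ ψ))) (encF φ) a <;> simp [h]
  | next φ ih =>
    intro a ha
    have l1 : encF φ < encF (.next φ) := lt_pair_pos 3 _ (by omega)
    have d1 : m * tdeg (.next φ) = m * tdeg φ + m := by rw [tdeg]; ring
    rw [sat, ← ih (a + 1) (by omega), ← look_table m v A _ _ _ l1 (by omega)]
    have e : (encF (.next φ)).unpair = (3, encF φ) := by simp [encF]
    simp only [stepBit, table_length, e]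
    simp
  | untl φ ψ ih1 ih2 =>
    intro a ha
    have l1 : encF φ < encF (.untl φ ψ) :=
      lt_of_le_of_lt (Nat.left_le_pair _ _) (lt_pair_pos 4 _ (by omega))
    have l2 : encF ψ < encF (.untl φ ψ) :=
      lt_of_le_of_lt (Nat.right_le_pair _ _) (lt_pair_pos 4 _ (by omega))
    have d1 : m * tdeg φ + m ≤ m * tdeg (.untl φ ψ) := by
      rw [← Nat.mul_succ]; exact Nat.mul_le_mul_left _ (Nat.succ_le_succ (le_max_left _ _))
    have d2 : m * tdeg ψ + m ≤ m * tdeg (.untl φ ψ) := by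
      rw [← Nat.mul_succ]; exact Nat.mul_le_mul_left _ (Nat.succ_le_succ (le_max_right _ _))
    have e : (encF (.untl φ ψ)).unpair = (4, Nat.pair (encF φ) (encF ψ)) := by simp [encF]
    have key := unt_iff (table m v A (encF (.untl φ ψ))) (encF φ) (encF ψ)
      (sat (· + m) (val v) φ) (sat (· + m) (val v) ψ) (a + m)
      (fun c hc => by rw [look_table m v A _ _ _ l1 (by omega), ih1 c (by omega)])
      (fun c hc => by rw [look_table m v A _ _ _ l2 (by omega), ih2 c (by omega)])
      m a le_rfl
    simp only [sat]
    rw [← key]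
    simp only [stepBit, table_length, e]
    simp

theorem agree (m n A s : ℕ) (hm : 1 ≤ m) (V V' : ℕ → Set ℕ)
    (hV : ∀ p ≤ n, ∀ i ≤ A, (i + s ∈ V p ↔ i ∈ V' p)) (φ : Fml) :
    encF φ ≤ n → ∀ a, a + m * tdeg φ ≤ A →
    (sat (· + m) V φ (a + s) ↔ sat (· + m) V' φ a) := by
  induction φ with
  | letter p =>
    intro hn a ha
    exact hV p (le_trans (Nat.right_le_pair 0 p) hn) a (by omega)
  | bot => intro _ a _; simp [sat]
  | imp φ ψ ih1 ih2 =>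
    intro hn a ha
    have l1 : encF φ < encF (.imp φ ψ) :=
      lt_of_le_of_lt (Nat.left_le_pair _ _) (lt_pair_pos 2 _ (by omega))
    have l2 : encF ψ < encF (.imp φ ψ) :=
      lt_of_le_of_lt (Nat.right_le_pair _ _) (lt_pair_pos 2 _ (by omega))
    have d1 : m * tdeg φ ≤ m * tdeg (.imp φ ψ) := Nat.mul_le_mul_left _ (le_max_left _ _)
    have d2 : m * tdeg ψ ≤ m * tdeg (.imp φ ψ) := Nat.mul_le_mul_left _ (le_max_right _ _)
    simp only [sat]
    rw [ih1 (by omega) a (by omega), ih2 (by omega) a (by omega)]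
  | next φ ih =>
    intro hn a ha
    have l1 : encF φ < encF (.next φ) := lt_pair_pos 3 _ (by omega)
    have d1 : m * tdeg (.next φ) = m * tdeg φ + m := by rw [tdeg]; ring
    simp only [sat]
    rw [← ih (by omega) (a + 1) (by omega), add_right_comm]
  | untl φ ψ ih1 ih2 =>
    intro hn a ha
    have l1 : encF φ < encF (.untl φ ψ) :=
      lt_of_le_of_lt (Nat.left_le_pair _ _) (lt_pair_pos 4 _ (by omega))
    have l2 : encF ψ < encF (.untl φ ψ) :=
      lt_of_le_of_lt (Nat.right_le_pair _ _) (lt_pair_pos 4 _ (by omega))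
    have d1 : m * tdeg φ + m ≤ m * tdeg (.untl φ ψ) := by
      rw [← Nat.mul_succ]; exact Nat.mul_le_mul_left _ (Nat.succ_le_succ (le_max_left _ _))
    have d2 : m * tdeg ψ + m ≤ m * tdeg (.untl φ ψ) := by
      rw [← Nat.mul_succ]; exact Nat.mul_le_mul_left _ (Nat.succ_le_succ (le_max_right _ _))
    simp only [sat]
    constructor
    · rintro ⟨b, h1, h2, h3, h4⟩
      obtain ⟨b, rfl⟩ : ∃ d, b = d + s := ⟨b - s, by omega⟩
      refine ⟨b, by omega, by omega, (ih2 (by omega) b (by omega)).1 h3, fun c h5 h6 => ?_⟩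
      exact (ih1 (by omega) c (by omega)).1 (h4 (c + s) (by omega) (by omega))
    · rintro ⟨b, h1, h2, h3, h4⟩
      refine ⟨b + s, by omega, by omega, (ih2 (by omega) b (by omega)).2 h3, fun c h5 h6 => ?_⟩
      obtain ⟨c, rfl⟩ : ∃ d, c = d + s := ⟨c - s, by omega⟩
      exact (ih1 (by omega) c (by omega)).2 (h4 c (by omega) (by omega))

theorem tdeg_le (φ : Fml) : tdeg φ ≤ encF φ := by
  induction φ with
  | letter p => simp [tdeg]
  | bot => simp [tdeg]
  | imp φ ψ ih1 ih2 =>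
    have l0 := lt_pair_pos 2 (Nat.pair (encF φ) (encF ψ)) (by omega)
    have l1 := Nat.left_le_pair (encF φ) (encF ψ)
    have l2 := Nat.right_le_pair (encF φ) (encF ψ)
    simp only [tdeg, encF]; omega
  | next φ ih =>
    have l0 := lt_pair_pos 3 (encF φ) (by omega)
    simp only [tdeg, encF]; omega
  | untl φ ψ ih1 ih2 =>
    have l0 := lt_pair_pos 4 (Nat.pair (encF φ) (encF ψ)) (by omega)
    have l1 := Nat.left_le_pair (encF φ) (encF ψ)
    have l2 := Nat.right_le_pair (encF φ) (encF ψ)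
    simp only [tdeg, encF]; omega

theorem pair_mono {a b c d : ℕ} (h1 : a ≤ c) (h2 : b ≤ d) : Nat.pair a b ≤ Nat.pair c d :=
  le_trans (StrictMono.monotone (fun _ _ h => Nat.pair_lt_pair_left b h) h1)
    (StrictMono.monotone (fun _ _ h => Nat.pair_lt_pair_right c h) h2)

/-- bound on the codes of valuations -/
def bnd (m n : ℕ) : ℕ := 2 ^ (Nat.pair n (m * n) + 1)

theorem exists_code (m n s : ℕ) (V : ℕ → Set ℕ) : ∃ v < bnd m n,
    ∀ p ≤ n, ∀ i ≤ m * n, (i + s ∈ V p ↔ i ∈ val v p) := by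
  classical
  let g : Fin (Nat.pair n (m * n) + 1) → Bool :=
    fun k => decide ((Nat.unpair k).2 + s ∈ V (Nat.unpair k).1)
  refine ⟨Nat.ofBits g, Nat.ofBits_lt_two_pow g, fun p hp i hi => ?_⟩
  have hlt : Nat.pair p i < Nat.pair n (m * n) + 1 := Nat.lt_succ_of_le (pair_mono hp hi)
  have := Nat.testBit_ofBits_lt g (Nat.pair p i) hlt
  rw [Nat.testBit_eq_decide_div_mod_eq] at this
  simp only [val, bit, Set.mem_ofPred_eq, this]
  simp [g]

theorem main_iff (m : ℕ) (hm : 1 ≤ m) (φ : Fml) :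
    (∀ v < bnd m (encF φ),
      stepBit m v (table m v (m * encF φ) (encF φ)) 0 = true) ↔ φ ∈ LTLNTm m := by
  have hd : 0 + m * tdeg φ ≤ m * encF φ := by
    rw [zero_add]; exact Nat.mul_le_mul_left _ (tdeg_le φ)
  constructor
  · intro h V a
    obtain ⟨v, hv, hV⟩ := exists_code m (encF φ) a V
    have := agree m (encF φ) (m * encF φ) a hm V (val v) hV φ le_rfl 0 hd
    rw [zero_add] at this
    exact this.2 ((correct m v _ hm φ 0 hd).1 (h v hv))
  · intro h v _
    exact (correct m v _ hm φ 0 hd).2 (h (val v) 0)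

theorem dec_prim (m : ℕ) : PrimrecPred fun n : ℕ => ∀ v < bnd m n,
    stepBit m v (table m v (m * n) n) 0 = true := by
  have hR : PrimrecRel fun (v n : ℕ) => stepBit m v (table m v (m * n) n) 0 = true := by
    have hA : Primrec fun z : ℕ × ℕ => m * z.2 :=
      Primrec.nat_mul.comp (Primrec.const m) Primrec.snd
    have : Primrec fun z : ℕ × ℕ => stepBit m z.1 (table m z.1 (m * z.2) z.2) 0 :=
      stepBit_prim m Primrec.fst
        ((table_prim m).comp (Primrec.pair Primrec.fst hA) Primrec.snd) (Primrec.const 0)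
    exact (Primrec.eq.comp this (Primrec.const true))
  have hb : Primrec (bnd m) :=
    pow_prim.comp (Primrec.succ.comp (Primrec₂.natPair.comp Primrec.id
      (Primrec.nat_mul.comp (Primrec.const m) Primrec.id)))
  exact hR.forall_lt.comp hb Primrec.id

end NTDec

/-- for every m ≥ 1, the logic LTL_NT(m) is decidable. -/
theorem stmt6 (m : ℕ) (hm : 1 ≤ m) :
    ∃ f : ℕ → Bool, Computable f ∧
      ∀ φ : Fml, (f (encF φ) = true ↔ φ ∈ LTLNTm m) := by
  classical
  refine ⟨fun n => decide (∀ v < NTDec.bnd m n,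
    NTDec.stepBit m v (NTDec.table m v (m * n) n) 0 = true),
    (NTDec.dec_prim m).decide.to_comp, fun φ => ?_⟩
  rw [decide_eq_true_iff]
  exact NTDec.main_iff m hm φ
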